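/- Let k be a field, A a Hopf algebra over k with antipode S, v ∈ M_N(A) a corepresentation matrix, and E ∈ M_N(k) invertible with E^T = ±E and S(v) = E^{-1} v^T E. Suppose there exist primitive elements f_1, f_2, f_3 ∈ Hom_k(A,k) such that tr(F_1 F_2 F_3) ≠ 0, where (F_i)_{pq} = f_i(v_{pq}). Then the element c_V := Σ_{i,j,k,l} S(v_{ji}) ⊗ v_{ik} ⊗ S(v_{kl}) ⊗ v_{lj} + Σ_{i,j} 1 ⊗ v_{ij} ⊗ 1 ⊗ S(v_{ji}) ∈ A^{⊗4} satisfies b_3(c_V) = 0 and c_V is not in the image of b_4 : A^{⊗5} → A^{⊗4}. In particular, the third Hochschild homology group HH_3(A) is nonzero. -/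

import Mathlib

open TensorProduct Matrix

noncomputable section

variable (k A : Type*) [Field k] [Ring A] [HopfAlgebra k A]

/-- Multiply the first two tensor factors of `A ⊗ (A ⊗ M)`. -/
def mulFirst (M : Type*) [AddCommGroup M] [Module k M] :
    A ⊗[k] (A ⊗[k] M) →ₗ[k] A ⊗[k] M :=
  (TensorProduct.map (LinearMap.mul' k A) LinearMap.id) ∘ₗ
    (TensorProduct.assoc k A A M).symm.toLinearMap

/-- `A^{⊗3} ≃ A^{⊗2} ⊗ A`, pulling the last factor out. -/
def pull3 : A ⊗[k] (A ⊗[k] A) ≃ₗ[k] (A ⊗[k] A) ⊗[k] A :=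
  (TensorProduct.assoc k A A A).symm

/-- `A^{⊗4} ≃ A^{⊗3} ⊗ A`, pulling the last factor out. -/
def pull4 : A ⊗[k] (A ⊗[k] (A ⊗[k] A)) ≃ₗ[k] (A ⊗[k] (A ⊗[k] A)) ⊗[k] A :=
  (TensorProduct.congr (LinearEquiv.refl k A) (pull3 k A)).trans
    (TensorProduct.assoc k A (A ⊗[k] A) A).symm

/-- `A^{⊗5} ≃ A^{⊗4} ⊗ A`, pulling the last factor out. -/
def pull5 : A ⊗[k] (A ⊗[k] (A ⊗[k] (A ⊗[k] A)))
    ≃ₗ[k] (A ⊗[k] (A ⊗[k] (A ⊗[k] A))) ⊗[k] A :=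
  (TensorProduct.congr (LinearEquiv.refl k A) (pull4 k A)).trans
    (TensorProduct.assoc k A (A ⊗[k] (A ⊗[k] A)) A).symm

/-- Cyclic rotation `a₀ ⊗ ⋯ ⊗ a₄ ↦ a₄ ⊗ a₀ ⊗ ⋯ ⊗ a₃` of `A^{⊗5}`. -/
def rotate5 : A ⊗[k] (A ⊗[k] (A ⊗[k] (A ⊗[k] A)))
    ≃ₗ[k] A ⊗[k] (A ⊗[k] (A ⊗[k] (A ⊗[k] A))) :=
  (pull5 k A).trans (TensorProduct.comm k (A ⊗[k] (A ⊗[k] (A ⊗[k] A))) A)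

/-- The Hochschild boundary `b₄ : A^{⊗5} → A^{⊗4}`,
`a₀⊗⋯⊗a₄ ↦ a₀a₁⊗a₂⊗a₃⊗a₄ - a₀⊗a₁a₂⊗a₃⊗a₄ + a₀⊗a₁⊗a₂a₃⊗a₄ - a₀⊗a₁⊗a₂⊗a₃a₄
             + a₄a₀⊗a₁⊗a₂⊗a₃`. -/
def hochschildB4 : A ⊗[k] (A ⊗[k] (A ⊗[k] (A ⊗[k] A)))
    →ₗ[k] A ⊗[k] (A ⊗[k] (A ⊗[k] A)) :=
  mulFirst k A (A ⊗[k] (A ⊗[k] A))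
  + (-1 : k) • TensorProduct.map (LinearMap.id : A →ₗ[k] A) (mulFirst k A (A ⊗[k] A))
  + TensorProduct.map (LinearMap.id : A →ₗ[k] A)
      (TensorProduct.map (LinearMap.id : A →ₗ[k] A) (mulFirst k A A))
  + (-1 : k) • TensorProduct.map (LinearMap.id : A →ₗ[k] A)
      (TensorProduct.map (LinearMap.id : A →ₗ[k] A)
        (TensorProduct.map (LinearMap.id : A →ₗ[k] A) (LinearMap.mul' k A)))
  + (mulFirst k A (A ⊗[k] (A ⊗[k] A))) ∘ₗ (rotate5 k A).toLinearMap

/-- The Hochschild boundary `b₃ : A^{⊗4} → A^{⊗3}`,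
`a₀⊗a₁⊗a₂⊗a₃ ↦ a₀a₁⊗a₂⊗a₃ - a₀⊗a₁a₂⊗a₃ + a₀⊗a₁⊗a₂a₃ - a₃a₀⊗a₁⊗a₂`. -/
def rotate4 : A ⊗[k] (A ⊗[k] (A ⊗[k] A)) ≃ₗ[k] A ⊗[k] (A ⊗[k] (A ⊗[k] A)) :=
  (pull4 k A).trans (TensorProduct.comm k (A ⊗[k] (A ⊗[k] A)) A)

def hochschildB3 : A ⊗[k] (A ⊗[k] (A ⊗[k] A)) →ₗ[k] A ⊗[k] (A ⊗[k] A) :=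
  mulFirst k A (A ⊗[k] A)
  - TensorProduct.map (LinearMap.id : A →ₗ[k] A) (mulFirst k A A)
  + TensorProduct.map (LinearMap.id : A →ₗ[k] A)
      (TensorProduct.map (LinearMap.id : A →ₗ[k] A) (LinearMap.mul' k A))
  - (mulFirst k A (A ⊗[k] A)) ∘ₗ (rotate4 k A).toLinearMap

/-- A linear functional `f : A → k` is primitive if
`f(ab) = ε(a) f(b) + f(a) ε(b)` for all `a, b ∈ A`. -/
def IsPrimitiveFunctional (f : A →ₗ[k] k) : Prop :=
  ∀ a b : A, f (a * b) =
    Coalgebra.counit (R := k) a * f b + f a * Coalgebra.counit (R := k) b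

variable {k A}

theorem hochschildB3_tmul (a b c d : A) :
    hochschildB3 k A (a ⊗ₜ (b ⊗ₜ (c ⊗ₜ d))) =
      (a * b) ⊗ₜ (c ⊗ₜ d) - a ⊗ₜ ((b * c) ⊗ₜ d) + a ⊗ₜ (b ⊗ₜ (c * d))
        - (d * a) ⊗ₜ (b ⊗ₜ c) := rfl

theorem hochschildB4_tmul (a b c d e : A) :
    hochschildB4 k A (a ⊗ₜ (b ⊗ₜ (c ⊗ₜ (d ⊗ₜ e)))) =
      (a * b) ⊗ₜ (c ⊗ₜ (d ⊗ₜ e)) + (-1 : k) • a ⊗ₜ ((b * c) ⊗ₜ (d ⊗ₜ e))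
        + a ⊗ₜ (b ⊗ₜ ((c * d) ⊗ₜ e)) + (-1 : k) • a ⊗ₜ (b ⊗ₜ (c ⊗ₜ (d * e)))
        + (e * a) ⊗ₜ (b ⊗ₜ (c ⊗ₜ d)) := rfl

theorem IsPrimitiveFunctional.map_one {f : A →ₗ[k] k} (hf : IsPrimitiveFunctional k A f) :
    f 1 = 0 := by
  simpa using hf 1 1

/-- The functional `a ⊗ b ⊗ c ⊗ d ↦ ε(a) f(b) g(c) h(d)` on `A^{⊗4}`. -/
def counitCup (f g h : A →ₗ[k] k) : A ⊗[k] (A ⊗[k] (A ⊗[k] A)) →ₗ[k] k :=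
  LinearMap.mul' k k ∘ₗ TensorProduct.map Coalgebra.counit
    (LinearMap.mul' k k ∘ₗ TensorProduct.map f (LinearMap.mul' k k ∘ₗ TensorProduct.map g h))

theorem counitCup_tmul (f g h : A →ₗ[k] k) (a b c d : A) :
    counitCup f g h (a ⊗ₜ (b ⊗ₜ (c ⊗ₜ d))) =
      Coalgebra.counit (R := k) a * (f b * (g c * h d)) := rfl

/-- For primitive functionals, `counitCup` is a Hochschild cocycle. -/
theorem counitCup_comp_hochschildB4 {f g h : A →ₗ[k] k} (hf : IsPrimitiveFunctional k A f)
    (hg : IsPrimitiveFunctional k A g) (hh : IsPrimitiveFunctional k A h) :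
    counitCup f g h ∘ₗ hochschildB4 k A = 0 := by
  ext a b c d e
  simp only [TensorProduct.AlgebraTensorModule.curry_apply, TensorProduct.curry_apply,
    LinearMap.coe_restrictScalars, LinearMap.comp_apply, LinearMap.zero_apply,
    hochschildB4_tmul, map_add, map_smul, counitCup_tmul, Bialgebra.counit_mul, hf b c, hg c d,
    hh d e, smul_eq_mul]
  ring

theorem sum_comm_pairs {n M : Type*} [Fintype n] [AddCommMonoid M] (F : n → n → n → n → M) :
    ∑ i, ∑ j, ∑ a, ∑ s, F i j a s = ∑ s, ∑ a, ∑ i, ∑ j, F i j a s := by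
  calc ∑ i, ∑ j, ∑ a, ∑ s, F i j a s
      = ∑ p : n × n, ∑ q : n × n, F p.1 p.2 q.1 q.2 := by simp only [Fintype.sum_prod_type]
    _ = ∑ q : n × n, ∑ p : n × n, F p.1 p.2 q.1 q.2 := Finset.sum_comm
    _ = _ := by
      simp only [Fintype.sum_prod_type]
      exact Finset.sum_comm

section Corepresentation

variable {n : Type*} [Fintype n] [DecidableEq n] {v : Matrix n n A}

theorem sum_antipode_mul_of_corep
    (hΔ : ∀ i j, Coalgebra.comul (R := k) (v i j) = ∑ l, v i l ⊗ₜ[k] v l j)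
    (hε : ∀ i j, Coalgebra.counit (R := k) (v i j) = if i = j then 1 else 0) (i j : n) :
    ∑ l, HopfAlgebra.antipode k (v i l) * v l j = if i = j then 1 else 0 := by
  have h := HopfAlgebra.mul_antipode_rTensor_comul_apply (R := k) (v i j)
  rw [hΔ, hε] at h
  simpa [apply_ite (algebraMap k A)] using h

theorem sum_mul_antipode_of_corep
    (hΔ : ∀ i j, Coalgebra.comul (R := k) (v i j) = ∑ l, v i l ⊗ₜ[k] v l j)
    (hε : ∀ i j, Coalgebra.counit (R := k) (v i j) = if i = j then 1 else 0) (i j : n) :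
    ∑ l, v i l * HopfAlgebra.antipode k (v l j) = if i = j then 1 else 0 := by
  have h := HopfAlgebra.mul_antipode_lTensor_comul_apply (R := k) (v i j)
  rw [hΔ, hε] at h
  simpa [apply_ite (algebraMap k A)] using h

theorem IsPrimitiveFunctional.antipode_of_corep {f : A →ₗ[k] k}
    (hf : IsPrimitiveFunctional k A f)
    (hΔ : ∀ i j, Coalgebra.comul (R := k) (v i j) = ∑ l, v i l ⊗ₜ[k] v l j)
    (hε : ∀ i j, Coalgebra.counit (R := k) (v i j) = if i = j then 1 else 0) (i j : n) :
    f (HopfAlgebra.antipode k (v i j)) = -f (v i j) := by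
  have h := congrArg f (sum_antipode_mul_of_corep hΔ hε i j)
  have h0 : f (if i = j then 1 else 0) = 0 := by split_ifs <;> simp [hf.map_one]
  rw [h0, map_sum] at h
  simp only [hf _ _, HopfAlgebra.counit_antipode, hε, ite_mul, one_mul, zero_mul, mul_ite,
    mul_one, mul_zero, Finset.sum_add_distrib, Finset.sum_ite_eq, Finset.sum_ite_eq',
    Finset.mem_univ, if_true] at h
  exact eq_neg_of_add_eq_zero_right h

/-- Pairing `counitCup` with `c_V` gives `-tr(F G H)`. -/
theorem counitCup_corep {f g h : A →ₗ[k] k}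
    (hg : IsPrimitiveFunctional k A g)
    (hΔ : ∀ i j, Coalgebra.comul (R := k) (v i j) = ∑ l, v i l ⊗ₜ[k] v l j)
    (hε : ∀ i j, Coalgebra.counit (R := k) (v i j) = if i = j then 1 else 0) :
    counitCup f g h
      ((∑ i, ∑ j, ∑ l, ∑ m, HopfAlgebra.antipode (R := k) (v j i) ⊗ₜ[k]
          (v i l ⊗ₜ[k] (HopfAlgebra.antipode (R := k) (v l m) ⊗ₜ[k] v m j)))
        + ∑ i, ∑ j, (1 : A) ⊗ₜ[k]
            (v i j ⊗ₜ[k] ((1 : A) ⊗ₜ[k] HopfAlgebra.antipode (R := k) (v j i))))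
      = -Matrix.trace (v.map f * v.map g * v.map h) := by
  simp only [map_add, map_sum, counitCup_tmul, HopfAlgebra.counit_antipode, hε,
    hg.antipode_of_corep hΔ hε, hg.map_one, zero_mul, mul_zero, Finset.sum_const_zero, add_zero,
    ite_mul, one_mul, neg_mul, mul_neg, Finset.sum_neg_distrib]
  simp only [Matrix.trace, Matrix.diag, Matrix.mul_apply, Matrix.map_apply, Finset.sum_mul]
  congr 1
  refine Finset.sum_congr rfl fun i _ => ?_
  rw [Finset.sum_eq_single i, Finset.sum_comm]
  · simp [mul_assoc]
  · simp +contextual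
  · simp

/-- If `S(v) = E⁻¹ vᵀ E` with `Eᵀ = ±E`, the tensor `∑ S(v_{ij}) ⊗ v_{ji}` is symmetric. -/
theorem sum_antipode_tmul_comm {E : Matrix n n k} (hsym : Eᵀ = E ∨ Eᵀ = -E)
    (hSv : ∀ l m, HopfAlgebra.antipode (R := k) (v l m)
      = ∑ j, ∑ s, (E⁻¹ l j * E s m) • v s j) :
    ∑ i, ∑ j, HopfAlgebra.antipode k (v i j) ⊗ₜ[k] v j i =
      ∑ i, ∑ j, v i j ⊗ₜ[k] HopfAlgebra.antipode k (v j i) := by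
  have key : ∀ a b c d, E⁻¹ a b * E c d = E⁻¹ b a * E d c := by
    intro a b c d
    have hinv : E⁻¹ b a = (Eᵀ)⁻¹ a b := by rw [← Matrix.transpose_nonsing_inv]; rfl
    have htr : E d c = Eᵀ c d := rfl
    rw [hinv, htr]
    rcases hsym with h | h
    · rw [h]
    · have hn : (-E)⁻¹ = -E⁻¹ := by
        by_cases hE : IsUnit E.det
        · exact Matrix.inv_eq_left_inv (by simp [Matrix.nonsing_inv_mul _ hE])
        · have hE' : ¬ IsUnit (-E).det := by rwa [← h, Matrix.det_transpose]
          rw [Matrix.nonsing_inv_apply_not_isUnit _ hE, Matrix.nonsing_inv_apply_not_isUnit _ hE',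
            neg_zero]
      rw [h, hn]
      simp
  simp only [hSv, TensorProduct.sum_tmul, TensorProduct.tmul_sum, TensorProduct.tmul_smul,
    ← TensorProduct.smul_tmul']
  rw [sum_comm_pairs]
  refine Finset.sum_congr rfl fun s _ => Finset.sum_congr rfl fun a _ =>
    Finset.sum_congr rfl fun i _ => Finset.sum_congr rfl fun j _ => ?_
  rw [key i a s j]

/-- `c_V` is a Hochschild cycle. -/
theorem hochschildB3_corep
    (hΔ : ∀ i j, Coalgebra.comul (R := k) (v i j) = ∑ l, v i l ⊗ₜ[k] v l j)
    (hε : ∀ i j, Coalgebra.counit (R := k) (v i j) = if i = j then 1 else 0)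
    (hcomm : ∑ i, ∑ j, HopfAlgebra.antipode k (v i j) ⊗ₜ[k] v j i =
      ∑ i, ∑ j, v i j ⊗ₜ[k] HopfAlgebra.antipode k (v j i)) :
    hochschildB3 k A
      ((∑ i, ∑ j, ∑ l, ∑ m, HopfAlgebra.antipode (R := k) (v j i) ⊗ₜ[k]
          (v i l ⊗ₜ[k] (HopfAlgebra.antipode (R := k) (v l m) ⊗ₜ[k] v m j)))
        + ∑ i, ∑ j, (1 : A) ⊗ₜ[k]
            (v i j ⊗ₜ[k] ((1 : A) ⊗ₜ[k] HopfAlgebra.antipode (R := k) (v j i))))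
      = 0 := by
  have hl := sum_antipode_mul_of_corep hΔ hε
  have hr := sum_mul_antipode_of_corep hΔ hε
  have h₀ : ∑ i, ∑ j, ∑ l, ∑ m, (HopfAlgebra.antipode k (v j i) * v i l) ⊗ₜ[k]
      (HopfAlgebra.antipode k (v l m) ⊗ₜ[k] v m j) =
        ∑ i, ∑ j, (1 : A) ⊗ₜ[k] (v i j ⊗ₜ[k] HopfAlgebra.antipode k (v j i)) := by
    have h := congrArg (TensorProduct.mk k A (A ⊗[k] A) 1) hcomm
    simp only [map_sum, TensorProduct.mk_apply] at h
    rw [← h, Finset.sum_comm]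
    refine Finset.sum_congr rfl fun j _ => ?_
    rw [Finset.sum_comm, Finset.sum_eq_single j]
    · rw [Finset.sum_comm]
      simp only [← TensorProduct.sum_tmul, hl, if_true]
    · intro l _ hlj
      rw [Finset.sum_comm]
      simp [← TensorProduct.sum_tmul, hl, hlj.symm]
    · simp
  have h₁ : ∑ i, ∑ j, ∑ l, ∑ m, HopfAlgebra.antipode k (v j i) ⊗ₜ[k]
      ((v i l * HopfAlgebra.antipode k (v l m)) ⊗ₜ[k] v m j) =
        ∑ i, ∑ j, v i j ⊗ₜ[k] ((1 : A) ⊗ₜ[k] HopfAlgebra.antipode k (v j i)) := by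
    have h := congrArg (TensorProduct.map (LinearMap.id : A →ₗ[k] A)
      (TensorProduct.mk k A A 1)) hcomm
    simp only [map_sum, TensorProduct.map_tmul, LinearMap.id_apply, TensorProduct.mk_apply] at h
    rw [← h, Finset.sum_comm]
    refine Finset.sum_congr rfl fun j _ => Finset.sum_congr rfl fun i _ => ?_
    rw [Finset.sum_comm]
    simp only [← TensorProduct.tmul_sum, ← TensorProduct.sum_tmul, hr]
    congr 1
    simp [TensorProduct.ite_tmul]
  have h₂ : ∑ i, ∑ j, ∑ l, ∑ m, HopfAlgebra.antipode k (v j i) ⊗ₜ[k]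
      (v i l ⊗ₜ[k] (HopfAlgebra.antipode k (v l m) * v m j)) =
        ∑ i, ∑ j, HopfAlgebra.antipode k (v j i) ⊗ₜ[k] (v i j ⊗ₜ[k] (1 : A)) := by
    simp only [← TensorProduct.tmul_sum, hl]
    simp [TensorProduct.tmul_ite]
  have h₃ : ∑ i, ∑ j, ∑ l, ∑ m, (v m j * HopfAlgebra.antipode k (v j i)) ⊗ₜ[k]
      (v i l ⊗ₜ[k] HopfAlgebra.antipode k (v l m)) =
        ∑ i, ∑ j, (1 : A) ⊗ₜ[k] (v i j ⊗ₜ[k] HopfAlgebra.antipode k (v j i)) := by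
    refine Finset.sum_congr rfl fun i _ => ?_
    rw [Finset.sum_comm]
    refine Finset.sum_congr rfl fun l _ => ?_
    rw [Finset.sum_comm]
    simp [← TensorProduct.sum_tmul, hr, TensorProduct.ite_tmul]
  simp only [map_add, map_sum, hochschildB3_tmul, Finset.sum_add_distrib,
    Finset.sum_sub_distrib, h₀, h₁, h₂, h₃, one_mul, mul_one]
  abel

end Corepresentation

variable (k A)

/-- let `v` be a corepresentation matrix of a Hopf algebra `A`, and
`E ∈ Mₙ(k)` invertible with `Eᵀ = ±E` and `S(v) = E⁻¹ vᵀ E`. If there are primitive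
functionals `f₁, f₂, f₃` with `tr(F₁F₂F₃) ≠ 0` (where `(Fᵢ)ₚq = fᵢ(vₚq)`), then
`c_V = Σ S(v_{ji}) ⊗ v_{il} ⊗ S(v_{lm}) ⊗ v_{mj} + Σ 1 ⊗ v_{ij} ⊗ 1 ⊗ S(v_{ji})`
satisfies `b₃(c_V) = 0` and `c_V ∉ im b₄`; in particular
`HH₃(A) = ker b₃ / im b₄ ≠ 0`. -/
theorem cV_is_nontrivial_cycle (N : ℕ)
    (v : Matrix (Fin N) (Fin N) A)
    (hΔ : ∀ i j, Coalgebra.comul (R := k) (v i j) = ∑ l, v i l ⊗ₜ[k] v l j)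
    (hε : ∀ i j, Coalgebra.counit (R := k) (v i j) = if i = j then 1 else 0)
    (E : Matrix (Fin N) (Fin N) k) (hE : IsUnit E)
    (hsym : Eᵀ = E ∨ Eᵀ = -E)
    (hSv : ∀ l m, HopfAlgebra.antipode (R := k) (v l m)
      = ∑ j, ∑ s, (E⁻¹ l j * E s m) • v s j)
    (f₁ f₂ f₃ : A →ₗ[k] k)
    (hf₁ : IsPrimitiveFunctional k A f₁) (hf₂ : IsPrimitiveFunctional k A f₂)
    (hf₃ : IsPrimitiveFunctional k A f₃)
    (F₁ F₂ F₃ : Matrix (Fin N) (Fin N) k)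
    (hF₁ : ∀ p q, F₁ p q = f₁ (v p q)) (hF₂ : ∀ p q, F₂ p q = f₂ (v p q))
    (hF₃ : ∀ p q, F₃ p q = f₃ (v p q))
    (htr : Matrix.trace (F₁ * F₂ * F₃) ≠ 0) :
    hochschildB3 k A
      ((∑ i, ∑ j, ∑ l, ∑ m, HopfAlgebra.antipode (R := k) (v j i) ⊗ₜ[k]
          (v i l ⊗ₜ[k] (HopfAlgebra.antipode (R := k) (v l m) ⊗ₜ[k] v m j)))
        + ∑ i, ∑ j, (1 : A) ⊗ₜ[k]
            (v i j ⊗ₜ[k] ((1 : A) ⊗ₜ[k] HopfAlgebra.antipode (R := k) (v j i))))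
      = 0
    ∧
    ((∑ i, ∑ j, ∑ l, ∑ m, HopfAlgebra.antipode (R := k) (v j i) ⊗ₜ[k]
          (v i l ⊗ₜ[k] (HopfAlgebra.antipode (R := k) (v l m) ⊗ₜ[k] v m j)))
        + ∑ i, ∑ j, (1 : A) ⊗ₜ[k]
            (v i j ⊗ₜ[k] ((1 : A) ⊗ₜ[k] HopfAlgebra.antipode (R := k) (v j i))))
      ∉ LinearMap.range (hochschildB4 k A)
    ∧
    ¬ (LinearMap.ker (hochschildB3 k A) ≤ LinearMap.range (hochschildB4 k A)) := by
  have hcycle := hochschildB3_corep hΔ hε (sum_antipode_tmul_comm hsym hSv)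
  have hnot : ((∑ i, ∑ j, ∑ l, ∑ m, HopfAlgebra.antipode (R := k) (v j i) ⊗ₜ[k]
          (v i l ⊗ₜ[k] (HopfAlgebra.antipode (R := k) (v l m) ⊗ₜ[k] v m j)))
        + ∑ i, ∑ j, (1 : A) ⊗ₜ[k]
            (v i j ⊗ₜ[k] ((1 : A) ⊗ₜ[k] HopfAlgebra.antipode (R := k) (v j i))))
      ∉ LinearMap.range (hochschildB4 k A) := by
    rintro ⟨x, hx⟩
    have h := counitCup_corep (f := f₁) (h := f₃) hf₂ hΔ hε
    rw [← hx, ← LinearMap.comp_apply, counitCup_comp_hochschildB4 hf₁ hf₂ hf₃,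
      LinearMap.zero_apply, eq_comm, neg_eq_zero] at h
    apply htr
    convert h <;> ext p q <;> simp [hF₁, hF₂, hF₃]
  exact ⟨hcycle, hnot, fun hle => hnot (hle hcycle)⟩

end
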